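/- Let β = (π_ℓ)_{ℓ=1}^L be a non-redundant chainable architecture of depth L ≥ 2. Then for every matrix A of the appropriate size there exist factors X_ℓ ∈ D^{π_ℓ} (ℓ = 1,…,L) such that ‖A − X₁⋯X_L‖_F² ≤ Σ_{s=1}^{L−1} (E^{β_s}(A))². -/

import Mathlib

/-- A *pattern* is a tuple `(a, b, c, d)` of (positive) natural numbers. -/
structure Pattern where
  a : ℕ
  b : ℕ
  c : ℕ
  d : ℕ

namespace Pattern

/-- The entries of a pattern are positive integers. -/
def Pos (π : Pattern) : Prop := 0 < π.a ∧ 0 < π.b ∧ 0 < π.c ∧ 0 < π.d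

/-- Number of rows `a*b*d` of a `π`-factor. -/
def rows (π : Pattern) : ℕ := π.a * π.b * π.d

/-- Number of columns `a*c*d` of a `π`-factor. -/
def cols (π : Pattern) : ℕ := π.a * π.c * π.d

/-- `r(π₁, π₂) = a₁c₁/a₂ (= b₂d₂/d₁)`. -/
def rk (π₁ π₂ : Pattern) : ℕ := π₁.a * π₁.c / π₂.a

/-- A pair of patterns is *chainable* if `a₁c₁/a₂ = b₂d₂/d₁` is a positive integer,
`a₁ ∣ a₂` and `d₂ ∣ d₁`. -/
def Chainable (π₁ π₂ : Pattern) : Prop :=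
  π₂.a ∣ π₁.a * π₁.c ∧ π₁.d ∣ π₂.b * π₂.d ∧
    π₁.a * π₁.c / π₂.a = π₂.b * π₂.d / π₁.d ∧
    0 < π₁.a * π₁.c / π₂.a ∧ π₁.a ∣ π₂.a ∧ π₂.d ∣ π₁.d

/-- `π₁ * π₂ := (a₁, b₁d₁/d₂, a₂c₂/a₁, d₂)`. -/
instance : Mul Pattern :=
  ⟨fun π₁ π₂ => ⟨π₁.a, π₁.b * π₁.d / π₂.d, π₂.a * π₂.c / π₁.a, π₂.d⟩⟩

/-- `‖π‖₀ := a*b*c*d`. -/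
def norm0 (π : Pattern) : ℕ := π.a * π.b * π.c * π.d

end Pattern

open scoped Kronecker

/-- The flattening equivalence `(Fin a × Fin b) × Fin d ≃ Fin (a*b*d)`. -/
def kron3Equiv (a b d : ℕ) : (Fin a × Fin b) × Fin d ≃ Fin (a * b * d) :=
  (finProdFinEquiv.prodCongr (Equiv.refl (Fin d))).trans finProdFinEquiv

/-- The support matrix `S_π = I_a ⊗ 1_{b×c} ⊗ I_d ∈ {0,1}^{abd × acd}`. -/
def Pattern.S (π : Pattern) : Matrix (Fin π.rows) (Fin π.cols) ℕ :=
  Matrix.reindex (kron3Equiv π.a π.b π.d) (kron3Equiv π.a π.c π.d)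
    ((1 : Matrix (Fin π.a) (Fin π.a) ℕ) ⊗ₖ
      (Matrix.of fun _ _ => (1 : ℕ) : Matrix (Fin π.b) (Fin π.c) ℕ) ⊗ₖ
      (1 : Matrix (Fin π.d) (Fin π.d) ℕ))

/-- The support matrix `S_π`, extended by zero to an `ℕ × ℕ`-indexed array. -/
def SpatN (π : Pattern) : ℕ → ℕ → ℕ := fun i j =>
  if h : i < π.rows ∧ j < π.cols then π.S ⟨i, h.1⟩ ⟨j, h.2⟩ else 0

/-- `X` is (the extension by zero of) a `π`-factor: it vanishes outside the support of `S_π`. -/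
def IsFactorN (π : Pattern) (X : ℕ → ℕ → ℂ) : Prop :=
  ∀ i j, SpatN π i j = 0 → X i j = 0

/-- Product of matrices encoded as finitely supported `ℕ × ℕ`-indexed arrays. -/
noncomputable def nmul (f g : ℕ → ℕ → ℂ) : ℕ → ℕ → ℂ := fun i j => ∑' k, f i k * g k j

/-- `nprod X k = X 0 * X 1 * ⋯ * X k`. -/
noncomputable def nprod (X : ℕ → ℕ → ℕ → ℂ) : ℕ → ℕ → ℕ → ℂ
  | 0 => X 0
  | k + 1 => nmul (nprod X k) (X (k + 1))

/-- Frobenius norm. -/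
noncomputable def nfrob (f : ℕ → ℕ → ℂ) : ℝ := Real.sqrt (∑' i, ∑' j, ‖f i j‖ ^ 2)

/-- `A` is (the extension by zero of) a matrix of size `m × n`. -/
def SuppIn (m n : ℕ) (A : ℕ → ℕ → ℂ) : Prop := ∀ i j, A i j ≠ 0 → i < m ∧ j < n

/-- The set `B^β` of butterfly matrices for the architecture `β = (π 0, …, π (L-1))`. -/
def Bset (π : ℕ → Pattern) (L : ℕ) : Set (ℕ → ℕ → ℂ) :=
  { M | ∃ X : ℕ → ℕ → ℕ → ℂ, (∀ ℓ < L, IsFactorN (π ℓ) (X ℓ)) ∧ M = nprod X (L - 1) }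

/-- The approximation error `E^β(A) = inf_{B ∈ B^β} ‖A - B‖_F`. -/
noncomputable def Eerr (π : ℕ → Pattern) (L : ℕ) (A : ℕ → ℕ → ℂ) : ℝ :=
  sInf { e : ℝ | ∃ B ∈ Bset π L, e = nfrob (A - B) }

/-- Partial products of patterns: `pprod π q k = π q * π (q+1) * ⋯ * π (q+k)`. -/
def pprod (π : ℕ → Pattern) (q : ℕ) : ℕ → Pattern
  | 0 => π q
  | k + 1 => pprod π q k * π (q + k + 1)

/-- The two-pattern architecture `(p, q)`. -/
def pairArch (p q : Pattern) : ℕ → Pattern := fun ℓ => if ℓ = 0 then p else q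

/-- The error `E^{β_s}(A)` of the split architecture
`β_s = (π 1 * ⋯ * π s, π (s+1) * ⋯ * π L)` (here `s` counts the factors in the left part). -/
noncomputable def Esplit (π : ℕ → Pattern) (L s : ℕ) (A : ℕ → ℕ → ℂ) : ℝ :=
  Eerr (pairArch (pprod π 0 (s - 1)) (pprod π s (L - 1 - s))) 2 A

/-- A chainable pair is *redundant* if `r(π₁,π₂) ≥ min (b₁, c₂)`. -/
def RedundantPair (π₁ π₂ : Pattern) : Prop := min π₁.b π₂.c ≤ Pattern.rk π₁ π₂

/-- The squared Euclidean norm of a complex vector. -/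
noncomputable def sqNorm {ι : Type*} [Fintype ι] (x : ι → ℂ) : ℝ := ∑ i, ‖x i‖ ^ 2

section PartialIsometry

open Matrix

variable {ι κ : Type*} [Fintype ι] [Fintype κ]

lemma sqNorm_nonneg (x : ι → ℂ) : 0 ≤ sqNorm x :=
  Finset.sum_nonneg fun _ _ => by positivity

lemma ofReal_sqNorm (x : ι → ℂ) : (sqNorm x : ℂ) = star x ⬝ᵥ x := by
  simp [sqNorm, dotProduct, ← Complex.conj_mul']

lemma sqNorm_add_of_orthogonal {x y : ι → ℂ} (h : star x ⬝ᵥ y = 0) :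
    sqNorm (x + y) = sqNorm x + sqNorm y := by
  have h' : star y ⬝ᵥ x = 0 := by
    rw [← star_star (star y ⬝ᵥ x), star_dotProduct, star_star, h, star_zero]
  apply Complex.ofReal_injective
  rw [Complex.ofReal_add]
  simp only [ofReal_sqNorm, star_add, add_dotProduct, dotProduct_add, h, h']
  ring

lemma star_mulVec_dotProduct (U : Matrix ι κ ℂ) (x : κ → ℂ) (y : ι → ℂ) :
    star (U *ᵥ x) ⬝ᵥ y = star x ⬝ᵥ (Uᴴ *ᵥ y) := by
  rw [star_mulVec, dotProduct_mulVec]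

variable {U : Matrix ι κ ℂ}

lemma sqNorm_eq_add_of_partialIsometry (hU : U * Uᴴ * U = U) (x : ι → ℂ) :
    sqNorm x = sqNorm (Uᴴ *ᵥ x) + sqNorm (x - U *ᵥ (Uᴴ *ᵥ x)) := by
  have hU' : Uᴴ * (U * Uᴴ) = Uᴴ := by
    simpa [Matrix.mul_assoc] using congrArg conjTranspose hU
  have h1 : Uᴴ *ᵥ (U *ᵥ (Uᴴ *ᵥ x)) = Uᴴ *ᵥ x := by
    simp only [mulVec_mulVec, hU']
  have h2 : sqNorm (U *ᵥ (Uᴴ *ᵥ x)) = sqNorm (Uᴴ *ᵥ x) := by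
    apply Complex.ofReal_injective
    rw [ofReal_sqNorm, ofReal_sqNorm, star_mulVec_dotProduct, h1]
  rw [← h2, ← sqNorm_add_of_orthogonal, add_sub_cancel]
  rw [star_mulVec_dotProduct, mulVec_sub, h1, sub_self, dotProduct_zero]

lemma sqNorm_conjTranspose_mulVec_le (hU : U * Uᴴ * U = U) (x : ι → ℂ) :
    sqNorm (Uᴴ *ᵥ x) ≤ sqNorm x := by
  have := sqNorm_eq_add_of_partialIsometry hU x
  linarith [sqNorm_nonneg (x - U *ᵥ (Uᴴ *ᵥ x))]

lemma sqNorm_mulVec_le (hU : U * Uᴴ * U = U) (x : κ → ℂ) : sqNorm (U *ᵥ x) ≤ sqNorm x := by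
  have hU' : Uᴴ * Uᴴᴴ * Uᴴ = Uᴴ := by
    simpa [Matrix.mul_assoc] using congrArg conjTranspose hU
  simpa using sqNorm_conjTranspose_mulVec_le hU' x

lemma sqNorm_sub_proj_le (hU : U * Uᴴ * U = U) (x : ι → ℂ) {v : ι → ℂ}
    (hv : U *ᵥ (Uᴴ *ᵥ v) = v) : sqNorm (x - U *ᵥ (Uᴴ *ᵥ x)) ≤ sqNorm (x - v) := by
  have h := sqNorm_eq_add_of_partialIsometry hU (x - v)
  rw [mulVec_sub, mulVec_sub, hv, sub_sub_sub_cancel_right] at h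
  linarith [sqNorm_nonneg (Uᴴ *ᵥ x - Uᴴ *ᵥ v)]

lemma sqNorm_sub_mulVec_le (hU : U * Uᴴ * U = U) (x : ι → ℂ) (w : κ → ℂ) :
    sqNorm (x - U *ᵥ w) ≤ sqNorm (x - U *ᵥ (Uᴴ *ᵥ x)) + sqNorm (Uᴴ *ᵥ x - w) := by
  have hU' : Uᴴ * (U * Uᴴ) = Uᴴ := by
    simpa [Matrix.mul_assoc] using congrArg conjTranspose hU
  have h : x - U *ᵥ w = U *ᵥ (Uᴴ *ᵥ x - w) + (x - U *ᵥ (Uᴴ *ᵥ x)) := by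
    rw [mulVec_sub]; abel
  rw [h, sqNorm_add_of_orthogonal]
  · linarith [sqNorm_mulVec_le hU (Uᴴ *ᵥ x - w)]
  · rw [star_mulVec_dotProduct, mulVec_sub, mulVec_mulVec, mulVec_mulVec, Matrix.mul_assoc, hU',
      sub_self, dotProduct_zero]

/-- Gram–Schmidt: the column space of `Y` is the range of a partial isometry of the same shape. -/
lemma exists_partialIsometry {N : ℕ} (Y : Matrix ι (Fin N) ℂ) :
    ∃ U : Matrix ι (Fin N) ℂ, U * Uᴴ * U = U ∧ U * Uᴴ * Y = Y ∧ (∃ R : Matrix (Fin N) (Fin N) ℂ, U = Y * R) ∧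
      (∀ n, (∀ m, Y m n = 0) → ∀ m, U m n = 0) ∧ ∀ m n, ‖U m n‖ ≤ 1 := by
  let f : Fin N → EuclideanSpace ℂ ι := fun n => WithLp.toLp 2 fun m => Y m n
  let u := InnerProductSpace.gramSchmidtNormed ℂ f
  have hnorm : ∀ n, u n = 0 ∨ ‖u n‖ = 1 := fun n => by
    by_cases h : u n = 0
    · exact Or.inl h
    · exact Or.inr (InnerProductSpace.gramSchmidtNormed_unit_length' h)
  have horth : ∀ i j, i ≠ j → inner ℂ (u i) (u j) = 0 := fun i j hij => by
    simp [u, InnerProductSpace.gramSchmidtNormed, InnerProductSpace.gramSchmidt_orthogonal ℂ f hij]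
  have hspan : Submodule.span ℂ (Set.range u) = Submodule.span ℂ (Set.range f) := by
    rw [InnerProductSpace.span_gramSchmidtNormed_range, InnerProductSpace.span_gramSchmidt]
  have hinner : ∀ i j, inner ℂ (u i) (u j) = ∑ m, star (u i m) * u j m := fun i j => by
    simp [PiLp.inner_apply, mul_comm]
  let U : Matrix ι (Fin N) ℂ := of fun m n => u n m
  have hU : U * Uᴴ * U = U := by
    ext m n
    rw [Matrix.mul_assoc, mul_apply]
    have : ∀ k, (Uᴴ * U) k n = inner ℂ (u k) (u n) := fun k => by
      rw [hinner, mul_apply]; rfl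
    simp only [this]
    rw [Finset.sum_eq_single n (fun k _ hk => by rw [horth k n hk, mul_zero]) (by simp)]
    rcases hnorm n with h | h
    · simp [U, h]
    · rw [inner_self_eq_norm_sq_to_K, h]; simp
  have hY : ∃ R : Matrix (Fin N) (Fin N) ℂ, Y = U * R := by
    have : ∀ n, ∃ r : Fin N → ℂ, ∑ k, r k • u k = f n := fun n => by
      rw [← Submodule.mem_span_range_iff_exists_fun, hspan]
      exact Submodule.subset_span ⟨n, rfl⟩
    choose r hr using this
    refine ⟨of fun k n => r n k, ?_⟩
    ext m n
    have := congrArg (fun x : EuclideanSpace ℂ ι => x m) (hr n)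
    simp only [WithLp.ofLp_sum, Finset.sum_apply, WithLp.ofLp_smul, Pi.smul_apply,
      smul_eq_mul] at this
    rw [mul_apply]
    simpa [U, f, mul_comm] using this.symm
  refine ⟨U, hU, ?_, ?_, ?_, ?_⟩
  · obtain ⟨R, hR⟩ := hY
    rw [hR, ← Matrix.mul_assoc, hU]
  · have : ∀ n, ∃ r : Fin N → ℂ, ∑ k, r k • f k = u n := fun n => by
      rw [← Submodule.mem_span_range_iff_exists_fun, ← hspan]
      exact Submodule.subset_span ⟨n, rfl⟩
    choose r hr using this
    refine ⟨of fun k n => r n k, ?_⟩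
    ext m n
    have := congrArg (fun x : EuclideanSpace ℂ ι => x m) (hr n)
    simp only [WithLp.ofLp_sum, Finset.sum_apply, WithLp.ofLp_smul, Pi.smul_apply,
      smul_eq_mul] at this
    rw [mul_apply]
    simpa [U, f, mul_comm] using this.symm
  · intro n hn m
    have hf : f n = 0 := by ext m; simpa [f] using hn m
    have : u n = 0 := by
      have hg : InnerProductSpace.gramSchmidt ℂ f n = 0 := by
        rw [InnerProductSpace.gramSchmidt_def, hf]
        simp
      simp [u, InnerProductSpace.gramSchmidtNormed, hg]
    simp [U, this]
  · intro m n
    refine (PiLp.norm_apply_le (u n) m).trans ?_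
    rcases hnorm n with h | h <;> simp [h]

end PartialIsometry

section BestProjection

open Matrix

variable {ι κ ο : Type*}

open scoped Classical in
/-- The columns of `X` indexed by the support of column `y` of `T`; the others are set to zero. -/
noncomputable def colMask (T : κ → ο → Prop) (y : ο) (X : Matrix ι κ ℂ) : Matrix ι κ ℂ :=
  of fun m n => if T n y then X m n else 0

/-- The squared Frobenius norm. -/
noncomputable def frobSq [Fintype ι] [Fintype ο] (A : Matrix ι ο ℂ) : ℝ :=
  ∑ y, sqNorm fun m => A m y

open scoped Classical in
/-- The product `Xᴴ * A`, restricted to the support `T`. -/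
noncomputable def maskedAdjMul [Fintype ι] (T : κ → ο → Prop) (X : Matrix ι κ ℂ)
    (A : Matrix ι ο ℂ) : Matrix κ ο ℂ :=
  of fun n y => if T n y then (Xᴴ * A) n y else 0

lemma maskedAdjMul_col [Fintype ι] (T : κ → ο → Prop) (X : Matrix ι κ ℂ)
    (A : Matrix ι ο ℂ) (y : ο) :
    (fun n => maskedAdjMul T X A n y) = (colMask T y X)ᴴ *ᵥ fun m => A m y := by
  ext n
  by_cases h : T n y <;> simp [maskedAdjMul, colMask, mulVec, dotProduct, mul_apply, h]

lemma mul_col_eq_colMask [Fintype κ] {T : κ → ο → Prop} (X : Matrix ι κ ℂ) {Z : Matrix κ ο ℂ}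
    (hZ : ∀ n y, ¬ T n y → Z n y = 0) (y : ο) :
    (fun m => (X * Z) m y) = colMask T y X *ᵥ fun n => Z n y := by
  ext m
  simp only [mul_apply, colMask, mulVec, dotProduct, of_apply]
  refine Finset.sum_congr rfl fun n _ => ?_
  by_cases h : T n y <;> simp [h, hZ]

/-- If the rows and columns sharing a middle index split into blocks indexed by `c`, then every
`Y` supported in `S` has blockwise a partial isometry with the same range. -/
lemma exists_blockwise_partialIsometry [Fintype ι] {N : ℕ} {γ : Type*} {S : ι → Fin N → Prop}
    {T : Fin N → ο → Prop} {c : Fin N → γ}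
    (hT : ∀ n n' y, T n y → c n = c n' → T n' y)
    (hST : ∀ m n n' y, T n y → T n' y → S m n → S m n' → c n = c n')
    (hS : ∀ m n n', S m n → c n = c n' → S m n')
    (Y : Matrix ι (Fin N) ℂ) (hY : ∀ m n, ¬ S m n → Y m n = 0) :
    ∃ X : Matrix ι (Fin N) ℂ, (∀ m n, ¬ S m n → X m n = 0) ∧ (∀ m n, ‖X m n‖ ≤ 1) ∧
      ∀ y, colMask T y X * (colMask T y X)ᴴ * colMask T y X = colMask T y X ∧
        colMask T y X * (colMask T y X)ᴴ * colMask T y Y = colMask T y Y := by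
  classical
  let B : γ → Matrix ι (Fin N) ℂ → Matrix ι (Fin N) ℂ :=
    fun g G => of fun m n => if c n = g then G m n else 0
  choose U hU hUY hR hU0 hU1 using fun g => exists_partialIsometry (B g Y)
  have hUc : ∀ g m n, c n ≠ g → U g m n = 0 := fun g m n hn =>
    hU0 g n (fun m => by simp [B, hn]) m
  let X : Matrix ι (Fin N) ℂ := of fun m n => U (c n) m n
  have hXS : ∀ m n, ¬ S m n → X m n = 0 := by
    intro m n hmn
    obtain ⟨R, hR⟩ := hR (c n)
    simp only [X, of_apply]
    rw [hR, mul_apply]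
    refine Finset.sum_eq_zero fun k _ => ?_
    by_cases hk : c k = c n
    · simp [B, hk, hY m k fun h => hmn (hS _ _ _ h hk)]
    · simp [B, hk]
  have hBX : ∀ g, B g X = U g := fun g => by
    ext m n
    by_cases h : c n = g
    · subst h; simp [B, X]
    · simp [B, h, hUc]
  have key : ∀ G : Matrix ι (Fin N) ℂ, (∀ m n, ¬ S m n → G m n = 0) →
      (∀ g, U g * (U g)ᴴ * B g G = B g G) → ∀ y,
      colMask T y X * (colMask T y X)ᴴ * colMask T y G = colMask T y G := by
    intro G hG hGU y
    ext m n
    by_cases hn : T n y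
    · have h1 : colMask T y G m n = B (c n) G m n := by simp [colMask, B, hn]
      rw [h1, ← hGU (c n)]
      simp only [mul_apply, Finset.sum_mul]
      refine Finset.sum_congr rfl fun m' _ => Finset.sum_congr rfl fun n' _ => ?_
      by_cases hc : c n' = c n
      · simp [colMask, B, hn, hT n n' y hn hc.symm, X, hc]
      · rw [hUc (c n) m n' hc]
        simp only [zero_mul, mul_eq_zero]
        by_cases hn' : T n' y
        · by_cases hs : S m' n
          · have : X m' n' = 0 := hXS _ _ fun hs' => hc (hST _ _ _ _ hn' hn hs' hs)
            simp [colMask, this]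
          · simp [colMask, hG _ _ hs]
        · simp [colMask, hn']
    · rw [mul_apply]
      simp [colMask, hn]
  refine ⟨X, hXS, fun m n => hU1 _ _ _, fun y => ⟨key X hXS (fun g => ?_) y, key Y hY hUY y⟩⟩
  rw [hBX, hU]

/-- One step of the left-to-right factorization: a factor `X` whose blocks are partial isometries
that are optimal for `A`. -/
theorem exists_optimal_left_factor [Fintype ι] [Fintype ο] {N : ℕ} {γ : Type*}
    {S : ι → Fin N → Prop} {T : Fin N → ο → Prop} {c : Fin N → γ}
    (hT : ∀ n n' y, T n y → c n = c n' → T n' y)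
    (hST : ∀ m n n' y, T n y → T n' y → S m n → S m n' → c n = c n')
    (hS : ∀ m n n', S m n → c n = c n' → S m n') (A : Matrix ι ο ℂ) :
    ∃ X : Matrix ι (Fin N) ℂ, (∀ m n, ¬ S m n → X m n = 0) ∧
      (∀ (Y : Matrix ι (Fin N) ℂ) (Z W : Matrix (Fin N) ο ℂ), (∀ m n, ¬ S m n → Y m n = 0) → (∀ n y, ¬ T n y → Z n y = 0) →
        (∀ n y, ¬ T n y → W n y = 0) →
        frobSq (A - X * W) ≤ frobSq (A - Y * Z) + frobSq (maskedAdjMul T X A - W)) ∧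
      ∀ B : Matrix ι ο ℂ, frobSq (maskedAdjMul T X A - maskedAdjMul T X B) ≤ frobSq (A - B) := by
  let K : Set (ι → Fin N → ℂ) := {X | (∀ m n, ¬ S m n → X m n = 0) ∧ (∀ m n, ‖X m n‖ ≤ 1) ∧
    ∀ y, colMask T y (of X) * (colMask T y (of X))ᴴ * colMask T y (of X) = colMask T y (of X)}
  let F : (ι → Fin N → ℂ) → ℝ := fun X => ∑ y, sqNorm ((fun m => A m y) -
    colMask T y (of X) *ᵥ ((colMask T y (of X))ᴴ *ᵥ fun m => A m y))
  have hmask : ∀ y, Continuous fun X : ι → Fin N → ℂ => colMask T y (of X) := fun y => by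
    refine continuous_matrix fun m n => ?_
    by_cases h : T n y
    · simp only [colMask, of_apply, h, if_true]; fun_prop
    · simp only [colMask, of_apply, h, if_false]; fun_prop
  have hF : Continuous F := by
    refine continuous_finsetSum _ fun y _ => continuous_finsetSum _ fun m _ => ?_
    have : Continuous fun X : ι → Fin N → ℂ => (fun m => A m y) -
        colMask T y (of X) *ᵥ ((colMask T y (of X))ᴴ *ᵥ fun m => A m y) :=
      continuous_const.sub ((hmask y).matrix_mulVec
        ((hmask y).matrix_conjTranspose.matrix_mulVec continuous_const))
    exact (((continuous_apply m).comp this).norm).pow 2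
  have hKc : IsClosed K := by
    have h1 : IsClosed {X : ι → Fin N → ℂ | ∀ m n, ¬ S m n → X m n = 0} := by
      simp only [Set.ofPred_forall]
      exact isClosed_iInter fun m => isClosed_iInter fun n => isClosed_iInter fun _ =>
        isClosed_eq (by fun_prop) continuous_const
    have h2 : IsClosed {X : ι → Fin N → ℂ | ∀ m n, ‖X m n‖ ≤ 1} := by
      simp only [Set.ofPred_forall]
      exact isClosed_iInter fun m => isClosed_iInter fun n =>
        isClosed_le (by fun_prop) continuous_const
    have h3 : IsClosed {X : ι → Fin N → ℂ | ∀ y, colMask T y (of X) * (colMask T y (of X))ᴴ *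
        colMask T y (of X) = colMask T y (of X)} := by
      simp only [Set.ofPred_forall]
      exact isClosed_iInter fun y => isClosed_eq
        (((hmask y).matrix_mul (hmask y).matrix_conjTranspose).matrix_mul (hmask y)) (hmask y)
    exact h1.inter (h2.inter h3)
  have hK : IsCompact K := by
    refine (isCompact_univ_pi fun _ : ι => isCompact_univ_pi fun _ : Fin N =>
      isCompact_closedBall (0 : ℂ) 1).of_isClosed_subset hKc fun X hX => ?_
    simpa using hX.2.1
  have hne : K.Nonempty := by
    refine ⟨0, by simp, by simp, fun y => ?_⟩
    have : colMask T y (of (0 : ι → Fin N → ℂ)) = 0 := by ext; simp [colMask]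
    rw [this]; simp
  obtain ⟨X, ⟨hXS, -, hXP⟩, hmin⟩ := hK.exists_isMinOn hne hF.continuousOn
  refine ⟨of X, hXS, fun Y Z W hY hZ hW => ?_, fun B => ?_⟩
  · have h1 : F X ≤ frobSq (A - Y * Z) := by
      obtain ⟨X', h1, h2, h3⟩ := exists_blockwise_partialIsometry hT hST hS Y hY
      refine (hmin (show X' ∈ K from ⟨h1, h2, fun y => (h3 y).1⟩)).trans ?_
      refine Finset.sum_le_sum fun y _ => ?_
      have e : (fun m => (A - Y * Z) m y) = (fun m => A m y) - fun m => (Y * Z) m y := rfl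
      rw [e]
      refine sqNorm_sub_proj_le (h3 y).1 _ ?_
      rw [mul_col_eq_colMask Y hZ]
      simp only [mulVec_mulVec]
      have := (h3 y).2
      rw [Matrix.mul_assoc] at this
      exact congrArg (· *ᵥ _) this
    have h2 : frobSq (A - of X * W) ≤ F X + frobSq (maskedAdjMul T (of X) A - W) := by
      simp only [frobSq, F]
      rw [← Finset.sum_add_distrib]
      refine Finset.sum_le_sum fun y _ => ?_
      have e : (fun m => (A - of X * W) m y) = (fun m => A m y) - fun m => (of X * W) m y := rfl
      have e' : (fun n => (maskedAdjMul T (of X) A - W) n y) =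
        (fun n => maskedAdjMul T (of X) A n y) - fun n => W n y := rfl
      rw [e, e', mul_col_eq_colMask _ hW, maskedAdjMul_col]
      exact sqNorm_sub_mulVec_le (hXP y) _ _
    linarith
  · refine Finset.sum_le_sum fun y _ => ?_
    have e : (fun n => (maskedAdjMul T (of X) A - maskedAdjMul T (of X) B) n y) =
        (fun n => maskedAdjMul T (of X) A n y) - fun n => maskedAdjMul T (of X) B n y := rfl
    rw [e, maskedAdjMul_col, maskedAdjMul_col, ← mulVec_sub]
    exact sqNorm_conjTranspose_mulVec_le (hXP y) _

end BestProjection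
section Arrays

lemma nmul_apply_of_left {f g : ℕ → ℕ → ℂ} {N i j : ℕ} (hf : ∀ k, N ≤ k → f i k = 0) :
    nmul f g i j = ∑ k ∈ Finset.range N, f i k * g k j :=
  tsum_eq_sum fun k hk => by rw [hf k (by simpa using hk), zero_mul]

lemma nmul_assoc {f g : ℕ → ℕ → ℂ} (h : ℕ → ℕ → ℂ) {M N : ℕ}
    (hf : ∀ i k, M ≤ k → f i k = 0) (hg : ∀ i k, N ≤ k → g i k = 0) :
    nmul (nmul f g) h = nmul f (nmul g h) := by
  have hfg : ∀ i k, N ≤ k → nmul f g i k = 0 := fun i k hk => by simp [nmul, hg _ k hk]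
  ext i j
  rw [nmul_apply_of_left (hfg i), nmul_apply_of_left (hf i)]
  simp only [nmul_apply_of_left (hf _), nmul_apply_of_left (hg _), Finset.sum_mul,
    Finset.mul_sum, mul_assoc]
  exact Finset.sum_comm

lemma nprod_eq_zero_of_le {X : ℕ → ℕ → ℕ → ℂ} {k N : ℕ} (hX : ∀ i j, N ≤ j → X k i j = 0)
    (i j : ℕ) (hj : N ≤ j) : nprod X k i j = 0 := by
  cases k with
  | zero => exact hX i j hj
  | succ k => simp [nprod, nmul, hX _ j hj]

lemma nprod_succ_eq_nmul (X : ℕ → ℕ → ℕ → ℂ) (k : ℕ)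
    (hX : ∀ ℓ ≤ k, ∃ N, ∀ i j, N ≤ j → X ℓ i j = 0) :
    nprod X (k + 1) = nmul (X 0) (nprod (fun ℓ => X (ℓ + 1)) k) := by
  induction k with
  | zero => rfl
  | succ k ih =>
    obtain ⟨M, hM⟩ := hX 0 (Nat.zero_le _)
    obtain ⟨N, hN⟩ := hX (k + 1) le_rfl
    rw [nprod, ih fun ℓ hℓ => hX ℓ (by omega),
      nmul_assoc _ hM (nprod_eq_zero_of_le (X := fun ℓ => X (ℓ + 1)) hN)]
    rfl

/-- The top left `m × n` corner of an array, as a matrix. -/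
def toMat (m n : ℕ) (f : ℕ → ℕ → ℂ) : Matrix (Fin m) (Fin n) ℂ := Matrix.of fun i j => f i j

/-- The extension of a matrix by zero. -/
def ofMat {m n : ℕ} (M : Matrix (Fin m) (Fin n) ℂ) : ℕ → ℕ → ℂ := fun i j =>
  if h : i < m ∧ j < n then M ⟨i, h.1⟩ ⟨j, h.2⟩ else 0

lemma toMat_ofMat {m n : ℕ} (M : Matrix (Fin m) (Fin n) ℂ) : toMat m n (ofMat M) = M := by
  ext i j
  simp [toMat, ofMat]

lemma SuppIn.eq_zero_of_le_right {m n : ℕ} {f : ℕ → ℕ → ℂ} (hf : SuppIn m n f) (i j : ℕ)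
    (h : n ≤ j) : f i j = 0 := by
  by_contra h0
  exact absurd (hf i j h0).2 (by omega)

lemma SuppIn.eq_zero_of_le_left {m n : ℕ} {f : ℕ → ℕ → ℂ} (hf : SuppIn m n f) (i j : ℕ)
    (h : m ≤ i) : f i j = 0 := by
  by_contra h0
  exact absurd (hf i j h0).1 (by omega)

lemma SuppIn.sub {m n : ℕ} {f g : ℕ → ℕ → ℂ} (hf : SuppIn m n f) (hg : SuppIn m n g) :
    SuppIn m n (f - g) := by
  intro i j h
  by_cases h0 : f i j = 0
  · exact hg i j fun h1 => h (by simp [h0, h1])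
  · exact hf i j h0

lemma SuppIn.nmul {m n k l : ℕ} {f g : ℕ → ℕ → ℂ} (hf : SuppIn m n f) (hg : SuppIn k l g) :
    SuppIn m l (nmul f g) := by
  intro i j h
  by_contra hij
  rw [not_and_or, not_lt, not_lt] at hij
  apply h
  rcases hij with hi | hj
  · simp [_root_.nmul, hf.eq_zero_of_le_left i _ hi]
  · simp [_root_.nmul, hg.eq_zero_of_le_right _ j hj]

lemma toMat_nmul {m n l : ℕ} {f g : ℕ → ℕ → ℂ} (hf : SuppIn m n f) :
    toMat m l (nmul f g) = toMat m n f * toMat n l g := by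
  ext i j
  simp only [toMat, Matrix.of_apply, Matrix.mul_apply,
    nmul_apply_of_left (hf.eq_zero_of_le_right _)]
  exact (Fin.sum_univ_eq_sum_range (fun k => f i k * g k j) n).symm

lemma nfrob_sq {m n : ℕ} {f : ℕ → ℕ → ℂ} (hf : SuppIn m n f) :
    nfrob f ^ 2 = frobSq (toMat m n f) := by
  have h1 : ∀ i, ∑' j, ‖f i j‖ ^ 2 = ∑ j ∈ Finset.range n, ‖f i j‖ ^ 2 := fun i =>
    tsum_eq_sum fun j hj => by simp [hf.eq_zero_of_le_right i j (by simpa using hj)]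
  have h2 : ∑' i, ∑' j, ‖f i j‖ ^ 2 =
      ∑ i ∈ Finset.range m, ∑ j ∈ Finset.range n, ‖f i j‖ ^ 2 := by
    simp only [h1]
    exact tsum_eq_sum fun i hi => Finset.sum_eq_zero fun j _ => by
      simp [hf.eq_zero_of_le_left i j (by simpa using hi)]
  rw [nfrob, Real.sq_sqrt (by rw [h2]; positivity), h2, Finset.sum_comm, frobSq,
    ← Fin.sum_univ_eq_sum_range]
  refine Finset.sum_congr rfl fun j _ => ?_
  rw [← Fin.sum_univ_eq_sum_range (fun i => ‖f i j‖ ^ 2)]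
  rfl

lemma nfrob_nonneg (f : ℕ → ℕ → ℂ) : 0 ≤ nfrob f := Real.sqrt_nonneg _

end Arrays

section Support

/-- The support of `I_a ⊗ 1 ⊗ I_d` of size `N × M`. -/
def KronSupp (a d N M i j : ℕ) : Prop := i < N ∧ j < M ∧ i / (N / a) = j / (M / a) ∧ i % d = j % d

lemma spatN_ne_zero_iff {π : Pattern} (ha : 0 < π.a) (i j : ℕ) :
    SpatN π i j ≠ 0 ↔ KronSupp π.a π.d π.rows π.cols i j := by
  have hr : π.rows / π.a = π.d * π.b := by
    rw [Pattern.rows, mul_assoc, Nat.mul_div_cancel_left _ ha, mul_comm]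
  have hc : π.cols / π.a = π.d * π.c := by
    rw [Pattern.cols, mul_assoc, Nat.mul_div_cancel_left _ ha, mul_comm]
  rw [KronSupp, hr, hc, ← Nat.div_div_eq_div_mul, ← Nat.div_div_eq_div_mul]
  by_cases h : i < π.rows ∧ j < π.cols
  · let x := (kron3Equiv π.a π.b π.d).symm ⟨i, h.1⟩
    let y := (kron3Equiv π.a π.c π.d).symm ⟨j, h.2⟩
    have hS : π.S ⟨i, h.1⟩ ⟨j, h.2⟩ = (1 : Matrix (Fin π.a) (Fin π.a) ℕ) x.1.1 y.1.1 * 1 *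
      (1 : Matrix (Fin π.d) (Fin π.d) ℕ) x.2 y.2 := rfl
    rw [SpatN, dif_pos h, hS]
    simp [x, y, h, kron3Equiv, Matrix.one_apply, Fin.ext_iff, finProdFinEquiv, Fin.divNat,
      Fin.modNat]
    exact and_comm
  · simp only [SpatN, h, dite_false, ne_eq, not_true_eq_false, false_iff]
    exact fun h' => h ⟨h'.1, h'.2.1⟩

lemma isFactorN_iff {π : Pattern} (ha : 0 < π.a) (X : ℕ → ℕ → ℂ) :
    IsFactorN π X ↔ ∀ i j, ¬ KronSupp π.a π.d π.rows π.cols i j → X i j = 0 := by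
  simp only [IsFactorN, ← spatN_ne_zero_iff ha, not_not]

lemma IsFactorN.kronSupp {π : Pattern} {X : ℕ → ℕ → ℂ} (hX : IsFactorN π X) (ha : 0 < π.a)
    {i j : ℕ} (h : X i j ≠ 0) : KronSupp π.a π.d π.rows π.cols i j := by
  by_contra h'
  exact h ((isFactorN_iff ha X).1 hX i j h')

lemma IsFactorN.suppIn {π : Pattern} {X : ℕ → ℕ → ℂ} (hX : IsFactorN π X) :
    SuppIn π.rows π.cols X := by
  intro i j h
  by_contra h'
  exact h (hX i j (by simp [SpatN, h']))

lemma isFactorN_zero (π : Pattern) : IsFactorN π 0 := fun _ _ _ => rfl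

lemma isFactorN_ofMat {π : Pattern} (ha : 0 < π.a) {M : Matrix (Fin π.rows) (Fin π.cols) ℂ}
    (hM : ∀ (i : Fin π.rows) (j : Fin π.cols), ¬ KronSupp π.a π.d π.rows π.cols i j → M i j = 0) :
    IsFactorN π (ofMat M) := by
  rw [isFactorN_iff ha]
  intro i j h
  by_cases hij : i < π.rows ∧ j < π.cols
  · simp only [ofMat, hij, and_self, dite_true]
    exact hM ⟨i, hij.1⟩ ⟨j, hij.2⟩ h
  · simp [ofMat, hij]

lemma div_div_eq_of_dvd {a a' N i j M : ℕ} (ha : a ∣ a') (hN : a' ∣ N) (hM : a' ∣ M)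
    (ha' : 0 < a') (h : i / (N / a') = j / (M / a')) : i / (N / a) = j / (M / a) := by
  obtain ⟨k, rfl⟩ := ha
  obtain ⟨n, rfl⟩ := hN
  obtain ⟨m, rfl⟩ := hM
  have h0 : 0 < a := Nat.pos_of_mul_pos_right ha'
  rw [Nat.mul_div_cancel_left _ ha', Nat.mul_div_cancel_left _ ha'] at h
  rw [mul_assoc, mul_assoc, Nat.mul_div_cancel_left _ h0, Nat.mul_div_cancel_left _ h0,
    mul_comm k, mul_comm k, ← Nat.div_div_eq_div_mul, ← Nat.div_div_eq_div_mul, h]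

lemma mod_eq_of_dvd {d d' i j : ℕ} (hd : d ∣ d') (h : i % d' = j % d') : i % d = j % d := by
  exact Nat.ModEq.of_dvd hd h

lemma Pattern.a_dvd_rows (π : Pattern) : π.a ∣ π.rows := ⟨π.b * π.d, by rw [rows, mul_assoc]⟩

lemma Pattern.a_dvd_cols (π : Pattern) : π.a ∣ π.cols := ⟨π.c * π.d, by rw [cols, mul_assoc]⟩

end Support

section Peeling

lemma maskedAdjMul_mul {ι κ κ' ο : Type*} [Fintype ι] [Fintype κ'] {T : κ → ο → Prop}
    {T' : κ → κ' → Prop} {X : Matrix ι κ ℂ} {Y : Matrix ι κ' ℂ} {Z : Matrix κ' ο ℂ}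
    (h : ∀ m n p y, X m n ≠ 0 → Y m p ≠ 0 → Z p y ≠ 0 → (T n y ↔ T' n p)) :
    maskedAdjMul T X (Y * Z) = maskedAdjMul T' X Y * Z := by
  classical
  ext n y
  have h1 : maskedAdjMul T X (Y * Z) n y =
      ∑ m, ∑ p, if T n y then star (X m n) * (Y m p * Z p y) else 0 := by
    by_cases hT : T n y <;> simp [maskedAdjMul, hT, Matrix.mul_apply, Finset.mul_sum]
  have h2 : (maskedAdjMul T' X Y * Z) n y =
      ∑ p, ∑ m, if T' n p then star (X m n) * (Y m p * Z p y) else 0 := by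
    rw [Matrix.mul_apply]
    refine Finset.sum_congr rfl fun p _ => ?_
    by_cases hT : T' n p <;>
      simp [maskedAdjMul, hT, Matrix.mul_apply, Finset.sum_mul, mul_assoc]
  rw [h1, h2, Finset.sum_comm]
  refine Finset.sum_congr rfl fun p _ => Finset.sum_congr rfl fun m _ => ?_
  by_cases hX : X m n = 0
  · simp [hX]
  by_cases hY : Y m p = 0
  · simp [hY]
  by_cases hZ : Z p y = 0
  · simp [hZ]
  simp only [h m n p y hX hY hZ]

/-- Peeling off the leftmost factor: `X` is optimal for the split `(p, q)`, and the remainder `W`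
is at least as well approximable as `A` at every later split. -/
theorem exists_peeled_factor {p q : Pattern} (hp : 0 < p.a) (hq : 0 < q.a)
    (hpq : p.cols = q.rows) (ha : p.a ∣ q.a) (hd : q.d ∣ p.d) {A : ℕ → ℕ → ℂ}
    (hA : SuppIn p.rows q.cols A) :
    ∃ X W : ℕ → ℕ → ℂ, IsFactorN p X ∧ IsFactorN q W ∧
      (∀ Y Z W', IsFactorN p Y → IsFactorN q Z → IsFactorN q W' →
        nfrob (A - nmul X W') ^ 2 ≤ nfrob (A - nmul Y Z) ^ 2 + nfrob (W - W') ^ 2) ∧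
      ∀ l m r : Pattern, 0 < l.a → 0 < r.a → l.rows = p.rows → l.cols = r.rows → l.d = m.d →
        m.a = q.a → m.rows = q.rows → m.cols = r.rows → m.d ∣ p.d → r.cols = q.cols →
        r.d = q.d → q.a ∣ r.a → r.d ∣ m.d → ∀ Y Z, IsFactorN l Y → IsFactorN r Z →
        ∃ M, IsFactorN m M ∧ nfrob (W - nmul M Z) ≤ nfrob (A - nmul Y Z) := by
  let S : Fin p.rows → Fin p.cols → Prop := fun i j => KronSupp p.a p.d p.rows p.cols i j
  let T : Fin p.cols → Fin q.cols → Prop := fun i j => KronSupp q.a q.d q.rows q.cols i j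
  let c : Fin p.cols → ℕ × ℕ := fun n => (n / (q.rows / q.a), n % p.d)
  have hT : ∀ n n' y, T n y → c n = c n' → T n' y := by
    rintro n n' y ⟨-, h1, h2, h3⟩ hc
    obtain ⟨hc1, hc2⟩ := Prod.ext_iff.1 hc
    exact ⟨hpq ▸ n'.2, h1, hc1.symm.trans h2, (mod_eq_of_dvd hd hc2).symm.trans h3⟩
  have hST : ∀ m n n' y, T n y → T n' y → S m n → S m n' → c n = c n' := by
    rintro m n n' y ⟨-, -, h1, -⟩ ⟨-, -, h2, -⟩ ⟨-, -, -, h3⟩ ⟨-, -, -, h4⟩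
    exact Prod.ext (h1.trans h2.symm) (h3.symm.trans h4)
  have hcoarse : ∀ n n' : ℕ, n / (q.rows / q.a) = n' / (q.rows / q.a) →
      n / (p.cols / p.a) = n' / (p.cols / p.a) := by
    rw [hpq]
    exact fun n n' => div_div_eq_of_dvd ha q.a_dvd_rows q.a_dvd_rows hq
  have hS : ∀ m n n', S m n → c n = c n' → S m n' := by
    rintro m n n' ⟨h0, -, h2, h3⟩ hc
    obtain ⟨hc1, hc2⟩ := Prod.ext_iff.1 hc
    exact ⟨h0, n'.2, h2.trans (hcoarse _ _ hc1), h3.trans hc2⟩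
  obtain ⟨X, hX, hXW, hXB⟩ :=
    exists_optimal_left_factor hT hST hS (toMat p.rows q.cols A)
  have hXf : IsFactorN p (ofMat X) := isFactorN_ofMat hp hX
  have hWf : IsFactorN q (ofMat (maskedAdjMul T X (toMat p.rows q.cols A))) := by
    rw [isFactorN_iff hq]
    intro i j hij
    by_cases h : i < p.cols ∧ j < q.cols
    · simp [ofMat, h, maskedAdjMul, T, hij]
    · simp [ofMat, h]
  have hfac : ∀ {V : ℕ → ℕ → ℂ}, IsFactorN q V → SuppIn p.cols q.cols V := fun hV => by
    rw [hpq]; exact hV.suppIn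
  have hfac0 : ∀ {V : ℕ → ℕ → ℂ}, IsFactorN q V → ∀ n y, ¬ T n y →
      toMat p.cols q.cols V n y = 0 := fun hV n y h => (isFactorN_iff hq _).1 hV n y h
  refine ⟨ofMat X, _, hXf, hWf, ?_, ?_⟩
  · intro Y Z W' hY hZ hW'
    rw [nfrob_sq (hA.sub (hXf.suppIn.nmul (hfac hW'))),
      nfrob_sq (hA.sub (hY.suppIn.nmul (hfac hZ))), nfrob_sq ((hfac hWf).sub (hfac hW'))]
    have := hXW (toMat _ _ Y) (toMat _ _ Z) (toMat _ _ W')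
      (fun m n h => (isFactorN_iff hp _).1 hY m n h) (hfac0 hZ) (hfac0 hW')
    rw [← toMat_nmul hY.suppIn] at this
    nth_rw 1 [← toMat_ofMat X, ← toMat_nmul hXf.suppIn] at this
    nth_rw 1 [← toMat_ofMat (maskedAdjMul T X _)] at this
    exact this
  · intro l m r hl hr hlp hlr hlm hma hmr hmc hmd hrc hrd hqr hrm Y Z hY hZ
    let M := maskedAdjMul (fun (n : Fin p.cols) (k : Fin r.rows) =>
      KronSupp m.a m.d m.rows m.cols n k) X (toMat p.rows r.rows Y)
    have hMs : SuppIn p.cols r.rows (ofMat M) := by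
      intro i j h
      by_contra h'
      exact h (by simp [ofMat, h'])
    have hYs : SuppIn p.rows r.rows Y := by rw [← hlp, ← hlr]; exact hY.suppIn
    have hZs : SuppIn r.rows q.cols Z := by rw [← hrc]; exact hZ.suppIn
    refine ⟨ofMat M, ?_, ?_⟩
    · rw [isFactorN_iff (hma ▸ hq)]
      intro i j hij
      by_cases h : i < p.cols ∧ j < r.rows
      · simp [ofMat, h, M, maskedAdjMul, hij]
      · simp [ofMat, h]
    · refine le_of_sq_le_sq ?_ (nfrob_nonneg _)
      rw [nfrob_sq ((hfac hWf).sub (hMs.nmul hZs)), nfrob_sq (hA.sub (hYs.nmul hZs))]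
      have := hXB (toMat p.rows q.cols (nmul Y Z))
      rw [toMat_nmul hYs, maskedAdjMul_mul (T' := fun (n : Fin p.cols) (k : Fin r.rows) =>
        KronSupp m.a m.d m.rows m.cols n k)] at this
      · rw [← toMat_nmul hYs] at this
        change frobSq (_ - M * _) ≤ _ at this
        rw [← toMat_ofMat M, ← toMat_nmul hMs] at this
        nth_rw 1 [← toMat_ofMat (maskedAdjMul T X _)] at this
        exact this
      · intro i n k y hXi hYi hZi
        obtain ⟨-, -, -, hX'⟩ : S i n := by
          by_contra h; exact hXi (hX _ _ h)
        obtain ⟨-, -, -, hY'⟩ := hY.kronSupp hl hYi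
        obtain ⟨-, -, hZa, hZd⟩ := hZ.kronSupp hr hZi
        have hnk : (n : ℕ) % m.d = k % m.d :=
          (mod_eq_of_dvd hmd hX').symm.trans (hlm ▸ hY')
        have hny : (n : ℕ) % q.d = y % q.d :=
          hrd ▸ (mod_eq_of_dvd hrm hnk).trans hZd
        have hky := div_div_eq_of_dvd hqr r.a_dvd_rows r.a_dvd_cols hr hZa
        simp only [T, KronSupp, hnk, hny, hma, hmr, hmc, ← hrc, hky]
        have := n.2
        have := y.2
        have := k.2
        simp_all

end Peeling

section Chain

variable {π : ℕ → Pattern}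

lemma Pattern.Chainable.cols_eq_rows {p q : Pattern} (h : p.Chainable q) : p.cols = q.rows := by
  obtain ⟨h1, h2, h3, -⟩ := h
  have e1 := Nat.mul_div_cancel' h1
  have e2 := Nat.mul_div_cancel' h2
  rw [Pattern.cols, Pattern.rows, ← e1, mul_assoc q.a q.b, ← e2, h3]
  ring

lemma pprod_spec {q k : ℕ} (hch : ∀ ℓ, q ≤ ℓ → ℓ < q + k → (π ℓ).Chainable (π (ℓ + 1))) :
    (pprod π q k).a = (π q).a ∧ (pprod π q k).d = (π (q + k)).d ∧
      (pprod π q k).rows = (π q).rows ∧ (pprod π q k).cols = (π (q + k)).cols ∧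
      (π q).a ∣ (π (q + k)).a ∧ (π (q + k)).d ∣ (π q).d := by
  induction k with
  | zero => simp [pprod]
  | succ k ih =>
    obtain ⟨h1, h2, h3, h4, h5, h6⟩ := ih fun ℓ h h' => hch ℓ h (by omega)
    obtain ⟨-, -, -, -, c1, c2⟩ := hch (q + k) (by omega) (by omega)
    have ha := h5.trans c1
    refine ⟨h1, rfl, ?_, ?_, ha, c2.trans h6⟩
    · rw [← h3]
      change (pprod π q k).a * ((pprod π q k).b * (pprod π q k).d / (π (q + k + 1)).d) *
        (π (q + k + 1)).d = (pprod π q k).a * (pprod π q k).b * (pprod π q k).d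
      rw [mul_assoc, Nat.div_mul_cancel (Dvd.dvd.mul_left (h2 ▸ c2) _), mul_assoc]
    · change (pprod π q k).a * ((π (q + k + 1)).a * (π (q + k + 1)).c / (pprod π q k).a) *
        (π (q + k + 1)).d = (π (q + k + 1)).a * (π (q + k + 1)).c * (π (q + k + 1)).d
      rw [Nat.mul_div_cancel' (Dvd.dvd.mul_right (h1 ▸ ha) _)]

lemma pprod_shift (q k : ℕ) : pprod (fun ℓ => π (ℓ + 1)) q k = pprod π (q + 1) k := by
  induction k with
  | zero => rfl
  | succ k ih => rw [pprod, pprod, ih, show q + 1 + k + 1 = q + k + 1 + 1 by ring]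

lemma IsFactorN.nprod {k : ℕ} {X : ℕ → ℕ → ℕ → ℂ} (ha : ∀ ℓ ≤ k, 0 < (π ℓ).a)
    (hch : ∀ ℓ < k, (π ℓ).Chainable (π (ℓ + 1))) (hX : ∀ ℓ ≤ k, IsFactorN (π ℓ) (X ℓ)) :
    IsFactorN (pprod π 0 k) (nprod X k) := by
  induction k with
  | zero => exact hX 0 le_rfl
  | succ k ih =>
    have hk := ih (fun ℓ h => ha ℓ (by omega)) (fun ℓ h => hch ℓ (by omega))
      fun ℓ h => hX ℓ (by omega)
    obtain ⟨p1, p2, p3, p4, p5, -⟩ :=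
      pprod_spec (π := π) (q := 0) (k := k) fun ℓ _ h => hch ℓ (by omega)
    obtain ⟨s1, s2, s3, s4, -, -⟩ :=
      pprod_spec (π := π) (q := 0) (k := k + 1) fun ℓ _ h => hch ℓ (by omega)
    simp only [zero_add] at p2 p4 p5 s2 s4
    have hc := hch k (by omega)
    have hcr := hc.cols_eq_rows
    obtain ⟨-, -, -, -, c1, c2⟩ := hc
    have h0 : 0 < (pprod π 0 k).a := p1 ▸ ha 0 (by omega)
    rw [isFactorN_iff (s1 ▸ ha 0 (by omega)), s1, s2, s3, s4]
    intro i j hij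
    refine (tsum_congr fun n => ?_).trans tsum_zero
    by_contra hne
    obtain ⟨hL, hR⟩ := mul_ne_zero_iff.1 hne
    obtain ⟨l1, -, l3, l4⟩ := hk.kronSupp h0 hL
    obtain ⟨-, r2, r3, r4⟩ := (hX (k + 1) le_rfl).kronSupp (ha _ le_rfl) hR
    rw [p1, p3, p4, hcr] at l3
    refine hij ⟨p3 ▸ l1, r2, l3.trans ?_, ?_⟩
    · exact div_div_eq_of_dvd (p5.trans c1) (Pattern.a_dvd_rows _) (Pattern.a_dvd_cols _)
        (ha _ le_rfl) r3
    · exact (mod_eq_of_dvd (p2 ▸ c2) l4).trans r4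

end Chain

section Errors

lemma mem_Bset_pairArch {p q : Pattern} {M : ℕ → ℕ → ℂ} :
    M ∈ Bset (pairArch p q) 2 ↔ ∃ Y Z, IsFactorN p Y ∧ IsFactorN q Z ∧ M = nmul Y Z := by
  constructor
  · rintro ⟨X, hX, rfl⟩
    exact ⟨X 0, X 1, hX 0 (by norm_num), hX 1 (by norm_num), rfl⟩
  · rintro ⟨Y, Z, hY, hZ, rfl⟩
    refine ⟨fun ℓ => if ℓ = 0 then Y else Z, fun ℓ hℓ => ?_, rfl⟩
    by_cases h : ℓ = 0 <;> simp [pairArch, h, hY, hZ]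

lemma Eerr_nonneg (π : ℕ → Pattern) (L : ℕ) (A : ℕ → ℕ → ℂ) : 0 ≤ Eerr π L A :=
  Real.sInf_nonneg fun _ ⟨_, _, he⟩ => he ▸ nfrob_nonneg _

lemma nonempty_errors (π : ℕ → Pattern) (L : ℕ) (A : ℕ → ℕ → ℂ) :
    {e : ℝ | ∃ B ∈ Bset π L, e = nfrob (A - B)}.Nonempty :=
  ⟨_, _, ⟨0, fun _ _ => isFactorN_zero _, rfl⟩, rfl⟩

lemma Eerr_le {π : ℕ → Pattern} {L : ℕ} {B : ℕ → ℕ → ℂ} (A : ℕ → ℕ → ℂ) (hB : B ∈ Bset π L) :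
    Eerr π L A ≤ nfrob (A - B) :=
  csInf_le ⟨0, fun _ ⟨_, _, he⟩ => he ▸ nfrob_nonneg _⟩ ⟨B, hB, rfl⟩

lemma le_Eerr {π : ℕ → Pattern} {L : ℕ} {A : ℕ → ℕ → ℂ} {t : ℝ}
    (h : ∀ B ∈ Bset π L, t ≤ nfrob (A - B)) : t ≤ Eerr π L A :=
  le_csInf (nonempty_errors π L A) fun _ ⟨B, hB, he⟩ => he ▸ h B hB

lemma le_Eerr_sq {π : ℕ → Pattern} {L : ℕ} {A : ℕ → ℕ → ℂ} {t : ℝ}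
    (h : ∀ B ∈ Bset π L, t ≤ nfrob (A - B) ^ 2) : t ≤ Eerr π L A ^ 2 :=
  Real.sqrt_le_left (Eerr_nonneg π L A) |>.1 <| le_Eerr fun B hB =>
    (Real.sqrt_le_left (nfrob_nonneg _)).2 (h B hB)

end Errors

/-- The error bound, with the sum over splits indexed from `0`, including depth one. -/
theorem exists_nprod_error_sq_le (k : ℕ) (π : ℕ → Pattern) (ha : ∀ ℓ ≤ k, 0 < (π ℓ).a)
    (hch : ∀ ℓ < k, (π ℓ).Chainable (π (ℓ + 1))) (A : ℕ → ℕ → ℂ)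
    (hA : SuppIn (π 0).rows (π k).cols A) (hA' : k = 0 → IsFactorN (π 0) A) :
    ∃ X : ℕ → ℕ → ℕ → ℂ, (∀ ℓ ≤ k, IsFactorN (π ℓ) (X ℓ)) ∧
      nfrob (A - nprod X k) ^ 2 ≤ ∑ s ∈ Finset.range k, Esplit π (k + 1) (s + 1) A ^ 2 := by
  induction k generalizing π A with
  | zero =>
    refine ⟨fun _ => A, fun ℓ hℓ => ?_, by simp [nprod, nfrob]⟩
    obtain rfl : ℓ = 0 := by omega
    exact hA' rfl
  | succ k ih =>
    obtain ⟨q1, q2, q3, q4, q5, q6⟩ :=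
      pprod_spec (π := π) (q := 1) (k := k) fun ℓ _ h => hch ℓ (by omega)
    have hk : 1 + k = k + 1 := add_comm _ _
    rw [hk] at q2 q4 q5 q6
    have hc := hch 0 (by omega)
    have hcr := hc.cols_eq_rows
    obtain ⟨-, -, -, -, c1, c2⟩ := hc
    have ha1 : 0 < (π 1).a := ha 1 (by omega)
    obtain ⟨X, W, hX, hW, hopt, hrest⟩ := exists_peeled_factor (p := π 0) (q := pprod π 1 k)
      (ha 0 (by omega)) (q1 ▸ ha1) (hcr.trans q3.symm) (q1 ▸ c1) (q2 ▸ q6.trans c2)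
      (A := A) (q4 ▸ hA)
    have hWs : SuppIn (π 1).rows (π (k + 1)).cols W := by
      have := hW.suppIn
      rwa [q3, q4] at this
    obtain ⟨X', hX', hW'⟩ := ih (fun ℓ => π (ℓ + 1)) (fun ℓ h => ha _ (by omega))
      (fun ℓ h => hch _ (by omega)) W hWs (by rintro rfl; exact hW)
    have hfac : IsFactorN (pprod π 1 k) (nprod X' k) := by
      rw [← pprod_shift]
      exact IsFactorN.nprod (fun ℓ h => ha _ (by omega)) (fun ℓ h => hch _ (by omega)) hX'
    let X'' : ℕ → ℕ → ℕ → ℂ := fun ℓ => Nat.casesOn ℓ X X'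
    have hX'' : ∀ ℓ ≤ k + 1, IsFactorN (π ℓ) (X'' ℓ) := by
      rintro (_ | ℓ) h
      · exact hX
      · exact hX' ℓ (by omega)
    refine ⟨X'', hX'', ?_⟩
    rw [nprod_succ_eq_nmul X'' k
      fun ℓ h => ⟨_, (hX'' ℓ (by omega)).suppIn.eq_zero_of_le_right⟩]
    change nfrob (A - nmul X (nprod X' k)) ^ 2 ≤ _
    have h1 : nfrob (A - nmul X (nprod X' k)) ^ 2 - nfrob (W - nprod X' k) ^ 2 ≤
        Esplit π (k + 1 + 1) 1 A ^ 2 := by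
      refine le_Eerr_sq fun B hB => ?_
      obtain ⟨Y, Z, hY, hZ, rfl⟩ := mem_Bset_pairArch.1 hB
      linarith [hopt Y Z _ hY hZ hfac]
    have h2 : ∀ s ∈ Finset.range k, Esplit (fun ℓ => π (ℓ + 1)) (k + 1) (s + 1) W ^ 2 ≤
        Esplit π (k + 1 + 1) (s + 1 + 1) A ^ 2 := by
      intro s hs
      rw [Finset.mem_range] at hs
      refine pow_le_pow_left₀ (Eerr_nonneg _ _ _) (le_Eerr fun B hB => ?_) 2
      obtain ⟨Y, Z, hY, hZ, rfl⟩ := mem_Bset_pairArch.1 hB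
      obtain ⟨l1, l2, l3, l4, -, l6⟩ :=
        pprod_spec (π := π) (q := 0) (k := s + 1) fun ℓ _ h => hch ℓ (by omega)
      obtain ⟨m1, m2, m3, m4, m5, m6⟩ :=
        pprod_spec (π := π) (q := 1) (k := s) fun ℓ _ h => hch ℓ (by omega)
      obtain ⟨r1, r2, r3, r4, -, r6⟩ :=
        pprod_spec (π := π) (q := s + 2) (k := k - 1 - s) fun ℓ _ h => hch ℓ (by omega)
      have hs1 : s + 2 + (k - 1 - s) = k + 1 := by omega
      have hs2 : 1 + s = s + 1 := add_comm _ _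
      rw [zero_add] at l2 l4 l6
      rw [hs2] at m2 m4 m5 m6
      rw [hs1] at r2 r4 r6
      have hc' := hch (s + 1) (by omega)
      have hcr' := hc'.cols_eq_rows
      obtain ⟨-, -, -, -, c1', c2'⟩ := hc'
      have e1 : k + 1 + 1 - 1 - (s + 1 + 1) = k - 1 - s := by omega
      have e2 : k + 1 - 1 - (s + 1) = k - 1 - s := by omega
      rw [e1] at hZ
      obtain ⟨M, hM, hle⟩ := hrest (pprod π 0 (s + 1)) (pprod π 1 s) (pprod π (s + 2) (k - 1 - s))
        (l1 ▸ ha 0 (by omega)) (r1 ▸ ha _ (by omega)) l3 (l4.trans (hcr'.trans r3.symm))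
        (l2.trans m2.symm) (m1.trans q1.symm) (m3.trans q3.symm) (m4.trans (hcr'.trans r3.symm))
        (m2 ▸ l6) (r4.trans q4.symm) (r2.trans q2.symm) (q1 ▸ r1 ▸ m5.trans c1')
        (m2 ▸ r2 ▸ r6.trans c2') Y Z hY hZ
      refine (Eerr_le W (mem_Bset_pairArch.2 ⟨M, Z, ?_, ?_, rfl⟩)).trans hle
      · rw [pprod_shift]; exact hM
      · rw [pprod_shift, e2]; exact hZ
    rw [Finset.sum_range_succ']
    linarith [Finset.sum_le_sum h2]

/-- **Theorem (approximation error, identity permutation).** For a non-redundant chainable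
architecture of depth `L ≥ 2` and any target matrix `A`, there exist butterfly factors whose
product approximates `A` within `√(∑_{s=1}^{L-1} E^{β_s}(A)²)` in Frobenius norm. -/
theorem butterfly_error_sq_sum (L : ℕ) (hL : 2 ≤ L) (π : ℕ → Pattern)
    (hPos : ∀ ℓ < L, (π ℓ).Pos)
    (hch : ∀ ℓ, ℓ + 1 < L → Pattern.Chainable (π ℓ) (π (ℓ + 1)))
    (hnr : ∀ ℓ, ℓ + 1 < L → ¬ RedundantPair (π ℓ) (π (ℓ + 1)))
    (A : ℕ → ℕ → ℂ) (hA : SuppIn (π 0).rows (π (L - 1)).cols A) :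
    ∃ X : ℕ → ℕ → ℕ → ℂ, (∀ ℓ < L, IsFactorN (π ℓ) (X ℓ)) ∧
      nfrob (A - nprod X (L - 1)) ^ 2 ≤ ∑ s ∈ Finset.Icc 1 (L - 1), Esplit π L s A ^ 2 := by
  obtain ⟨k, rfl⟩ : ∃ k, L = k + 1 := ⟨L - 1, by omega⟩
  obtain ⟨X, hX, h⟩ := exists_nprod_error_sq_le k π (fun ℓ h => (hPos ℓ (by omega)).1)
    (fun ℓ h => hch ℓ (by omega)) A hA (by omega)
  refine ⟨X, fun ℓ h => hX ℓ (by omega), h.trans_eq ?_⟩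
  rw [Finset.range_eq_Ico, Finset.sum_Ico_add' (fun s => Esplit π (k + 1) s A ^ 2) 0 k 1]
  rfl
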